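/- Let a, b, c be positive integers with b ≥ c. Every natural number n can be written as a·x² + b·t_y + c·t_z with x, y, z ∈ ℤ if and only if (a,b,c) is one of the fifteen triples (1,1,1), (1,2,1), (1,2,2), (1,3,1), (1,4,1), (1,4,2), (1,5,2), (1,6,1), (1,8,1), (2,1,1), (2,2,1), (2,4,1), (3,2,1), (4,1,1), (4,2,1). -/

import Mathlib

/-- The triangular number `t_k = k(k+1)/2` for an integer `k`. -/
def triZ (k : ℤ) : ℤ := k * (k + 1) / 2

lemma exists_two_mul_abs_add_mul_le {a : ℤ} (ha : 0 < a) (b : ℤ) :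
    ∃ k : ℤ, 2 * |b + k * a| ≤ a := by
  refine ⟨-((2 * b + a) / (2 * a)), ?_⟩
  have h1 := Int.emod_add_mul_ediv (2 * b + a) (2 * a)
  have h2 := Int.emod_nonneg (2 * b + a) (show 2 * a ≠ 0 by omega)
  have h3 := Int.emod_lt_of_pos (2 * b + a) (show 0 < 2 * a by omega)
  have h4 : |2 * (b + -((2 * b + a) / (2 * a)) * a)| ≤ a := by
    rw [abs_le]; constructor <;> nlinarith
  rwa [abs_mul, abs_two] at h4

/-- A positive definite classically integral ternary form of determinant one only takes values
that are sums of three squares. The form is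
`a x² + b y² + c z² + 2 d x y + 2 e x z + 2 f y z`. -/
theorem ternary_form_det_one (s : ℕ) : ∀ a b c d e f : ℤ, 0 < a → 0 < a * b - d ^ 2 →
    a * b * c + 2 * d * e * f - a * f ^ 2 - b * e ^ 2 - c * d ^ 2 = 1 →
    a + (a * b - d ^ 2) ≤ s → ∀ x y z : ℤ, ∃ u v w : ℤ,
      a * x ^ 2 + b * y ^ 2 + c * z ^ 2 + 2 * d * x * y + 2 * e * x * z + 2 * f * y * z
        = u ^ 2 + v ^ 2 + w ^ 2 := by
  induction s with
  | zero => intro a b c d e f ha hg _ hs; push_cast at hs; omega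
  | succ s ih =>
    intro a b c d e f ha hg hdet hs x y z
    push_cast at hs
    obtain ⟨k, hk⟩ := exists_two_mul_abs_add_mul_le ha d
    have hk2 : 4 * (d + k * a) ^ 2 ≤ a ^ 2 := by
      have := pow_le_pow_left₀ (by positivity) hk 2
      rwa [mul_pow, sq_abs] at this
    have hgk : a * (b + 2 * d * k + a * k ^ 2) - (d + k * a) ^ 2 = a * b - d ^ 2 := by ring
    by_cases hlt : b + 2 * d * k + a * k ^ 2 < a
    · have hpos : 0 < b + 2 * d * k + a * k ^ 2 :=
        pos_of_mul_pos_right (by nlinarith [sq_nonneg (d + k * a)]) ha.le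
      obtain ⟨u, v, w, h⟩ := ih (b + 2 * d * k + a * k ^ 2) a c (d + k * a) (f + k * e) e hpos
        (by linarith) (by rw [← hdet]; ring) (by linarith) y (x - k * y) z
      exact ⟨u, v, w, by rw [← h]; ring⟩
    have h1 : 3 * a ^ 2 ≤ 4 * (a * b - d ^ 2) := by
      push Not at hlt
      nlinarith
    clear hlt hgk hk2 hk k
    obtain ⟨k, hk⟩ := exists_two_mul_abs_add_mul_le hg (a * f - d * e)
    have hk2 : 4 * (a * f - d * e + k * (a * b - d ^ 2)) ^ 2 ≤ (a * b - d ^ 2) ^ 2 := by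
      have := pow_le_pow_left₀ (by positivity) hk 2
      rwa [mul_pow, sq_abs] at this
    have hgk : (a * b - d ^ 2) * (a * (c + 2 * f * k + b * k ^ 2) - (e + d * k) ^ 2)
        - (a * f - d * e + k * (a * b - d ^ 2)) ^ 2 = a := by
      linear_combination a * hdet
    by_cases hlt : a * (c + 2 * f * k + b * k ^ 2) - (e + d * k) ^ 2 < a * b - d ^ 2
    · have hpos : 0 < a * (c + 2 * f * k + b * k ^ 2) - (e + d * k) ^ 2 :=
        pos_of_mul_pos_right
          (by nlinarith [sq_nonneg (a * f - d * e + k * (a * b - d ^ 2))]) hg.le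
      obtain ⟨u, v, w, h⟩ := ih a (c + 2 * f * k + b * k ^ 2) b (e + d * k) d (f + b * k) ha
        hpos (by rw [← hdet]; ring) (by linarith) x z (y - k * z)
      exact ⟨u, v, w, by rw [← h]; ring⟩
    have h2 : 3 * (a * b - d ^ 2) ^ 2 ≤ 4 * a := by
      push Not at hlt
      nlinarith
    clear hlt hgk hk2 hk k ih
    obtain ⟨g, hgdef⟩ : ∃ g, g = a * b - d ^ 2 := ⟨_, rfl⟩
    rw [← hgdef] at h1 h2 hg
    have ha2 : a < 2 := by nlinarith
    obtain rfl : a = 1 := by omega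
    have hg2 : g < 2 := by nlinarith
    obtain rfl : g = 1 := by omega
    refine ⟨x + d * y + e * z, y + (f - d * e) * z, z, ?_⟩
    have hb : b = 1 + d ^ 2 := by linarith
    subst hb
    linear_combination z ^ 2 * hdet

lemma sum_three_squares_of_dvd {n b t : ℤ} (hb : 0 < b) (hm : 0 < b * n - 1)
    (h : b * n - 1 ∣ t ^ 2 + b) : ∃ x y z : ℤ, n = x ^ 2 + y ^ 2 + z ^ 2 := by
  obtain ⟨a, ha⟩ := h
  have hapos : 0 < a := pos_of_mul_pos_right (by nlinarith [sq_nonneg t]) hm.le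
  obtain ⟨u, v, w, h⟩ := ternary_form_det_one (a + b).toNat a (b * n - 1) n t 1 0 hapos
    (by nlinarith) (by linear_combination -n * ha) (by rw [Int.toNat_of_nonneg] <;> nlinarith)
    0 0 1
  exact ⟨u, v, w, by linarith⟩

lemma exists_sq_add_of_jacobiSym_neg {p : ℕ} [Fact p.Prime] {b : ℕ}
    (h : jacobiSym (-(b : ℤ)) p = 1) : ∃ t : ℤ, (p : ℤ) ∣ t ^ 2 + b := by
  obtain ⟨r, hr⟩ := ZMod.isSquare_of_jacobiSym_eq_one h
  refine ⟨(r.val : ℤ), ?_⟩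
  rw [← ZMod.intCast_zmod_eq_zero_iff_dvd]
  push_cast at hr ⊢
  rw [ZMod.natCast_zmod_val, sq, ← hr]
  ring

open NumberTheorySymbols in
lemma jacobiSym_neg_eq {p b : ℕ} (h : p % 4 = 1 ∧ b % 2 = 1 ∨ p % 4 = 3 ∧ b % 4 = 3) :
    J(-(b : ℤ) | p) = J(p | b) := by
  rcases h with ⟨hp, hb⟩ | ⟨hp, hb⟩
  · rw [jacobiSym.neg _ (Nat.odd_iff.2 (by omega)), ZMod.χ₄_nat_one_mod_four hp, one_mul,
      jacobiSym.quadratic_reciprocity_one_mod_four' (Nat.odd_iff.2 hb) hp]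
  · rw [jacobiSym.neg _ (Nat.odd_iff.2 (by omega)), ZMod.χ₄_nat_three_mod_four hp,
      jacobiSym.quadratic_reciprocity_three_mod_four hb hp]
    ring

open NumberTheorySymbols in
lemma sum_three_squares_of_two_mod_four {n : ℕ} (hn : n % 4 = 2) :
    ∃ x y z : ℤ, (n : ℤ) = x ^ 2 + y ^ 2 + z ^ 2 := by
  have hcop : (n - 1).Coprime (4 * n) := by
    refine Nat.Coprime.mul_right ?_ ?_
    · exact (Nat.Coprime.pow_right 2 (Nat.coprime_two_right.2 (Nat.odd_iff.2 (by omega))))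
    · have := Nat.coprime_self_sub_right (m := 1) (n := n) (by omega)
      simpa [Nat.coprime_comm] using this
  obtain ⟨p, hpn, hp, hmod⟩ := Nat.forall_exists_prime_gt_and_modEq n (q := 4 * n) (by omega) hcop
  have := Fact.mk hp
  obtain ⟨j, hj⟩ := (Nat.modEq_iff_dvd' (by omega)).1 hmod.symm
  have hpe : (p : ℤ) = ((4 * j + 1 : ℕ) : ℤ) * n - 1 := by
    have : p = 4 * n * j + (n - 1) := by omega
    rw [this]; push_cast [Nat.cast_sub (show 1 ≤ n by omega)]; ring
  have hp4 : p % 4 = 1 := by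
    have : p = 4 * (n * j) + (n - 1) := by rw [← mul_assoc]; omega
    omega
  have hJ : J(-((4 * j + 1 : ℕ) : ℤ) | p) = 1 := by
    rw [jacobiSym_neg_eq (by omega), jacobiSym.mod_left' (a₂ := -1),
      jacobiSym.at_neg_one (Nat.odd_iff.2 (by omega)), ZMod.χ₄_nat_one_mod_four (by omega)]
    rw [hpe]
    exact Int.ModEq.symm (Int.modEq_iff_dvd.2 ⟨n, by ring⟩)
  obtain ⟨t, ht⟩ := exists_sq_add_of_jacobiSym_neg hJ
  rw [hpe] at ht
  exact sum_three_squares_of_dvd (by positivity)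
    (by rw [← hpe]; exact_mod_cast hp.pos) ht

open NumberTheorySymbols in
lemma sum_three_squares_of_odd_aux {n c : ℕ}
    (h : n % 8 = 3 ∧ c = 1 ∨ n % 8 = 1 ∧ c = 3 ∨ n % 8 = 5 ∧ c = 3) :
    ∃ x y z : ℤ, (n : ℤ) = x ^ 2 + y ^ 2 + z ^ 2 := by
  obtain ⟨r, hr⟩ : ∃ r, c * n = 2 * r + 1 ∧ r % 2 = 1 := by
    refine ⟨(c * n - 1) / 2, ?_⟩
    rcases h with ⟨h, rfl⟩ | ⟨h, rfl⟩ | ⟨h, rfl⟩ <;> omega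
  have hcop : r.Coprime (4 * n) := by
    refine Nat.Coprime.mul_right ?_ ?_
    · exact (Nat.Coprime.pow_right 2 (Nat.coprime_two_right.2 (Nat.odd_iff.2 hr.2)))
    · rw [← Nat.isCoprime_iff_coprime]
      exact ⟨-2, c, by have := hr.1; zify at this; linarith⟩
  obtain ⟨p, hpn, hp, hmod⟩ := Nat.forall_exists_prime_gt_and_modEq (r + 2) (q := 4 * n)
    (by omega) hcop
  have := Fact.mk hp
  obtain ⟨j, hj⟩ := (Nat.modEq_iff_dvd' (by omega)).1 hmod.symm
  have hpj : p = 4 * (n * j) + r := by rw [← mul_assoc]; omega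
  obtain ⟨b, hb⟩ : ∃ b, b = 8 * j + c := ⟨_, rfl⟩
  have hpe : 2 * (p : ℤ) = (b : ℤ) * n - 1 := by
    have := hr.1
    zify at this
    rw [hpj, hb]; push_cast; linarith
  have hJ2 : J(2 * (p : ℤ) | b) = J(-1 | b) := by
    rw [jacobiSym.mod_left' (a₂ := -1)]
    rw [hpe]
    exact Int.ModEq.symm (Int.modEq_iff_dvd.2 ⟨n, by ring⟩)
  have hbodd : Odd b := Nat.odd_iff.2 (by omega)
  rw [jacobiSym.mul_left, jacobiSym.at_two hbodd, jacobiSym.at_neg_one hbodd,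
    ZMod.χ₈_nat_eq_if_mod_eight, ZMod.χ₄_nat_eq_if_mod_four] at hJ2
  have hJ : J(-(b : ℤ) | p) = 1 := by
    rw [jacobiSym_neg_eq]
    · rcases h with ⟨h, hc⟩ | ⟨h, hc⟩ | ⟨h, hc⟩
      · simpa [show b % 8 = 1 by omega, show b % 2 = 1 by omega,
          show b % 4 = 1 by omega] using hJ2
      all_goals simpa [show b % 8 = 3 by omega, show b % 2 = 1 by omega,
          show b % 4 = 3 by omega] using hJ2
    · rcases h with ⟨h, rfl⟩ | ⟨h, rfl⟩ | ⟨h, rfl⟩ <;> omega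
  obtain ⟨t, ht⟩ := exists_sq_add_of_jacobiSym_neg hJ
  have hpodd : (p : ℤ) % 2 = 1 := by omega
  obtain ⟨t', ht', hodd⟩ : ∃ t' : ℤ, (p : ℤ) ∣ t' ^ 2 + b ∧ t' % 2 = 1 := by
    rcases Int.emod_two_eq_zero_or_one t with h0 | h0
    · refine ⟨t + p, ?_, by omega⟩
      have : (t + p) ^ 2 + (b : ℤ) = (t ^ 2 + b) + p * (2 * t + p) := by ring
      rw [this]; exact dvd_add ht (dvd_mul_right _ _)
    · exact ⟨t, ht, h0⟩
  have h2 : (2 : ℤ) ∣ t' ^ 2 + b := by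
    have h1 : (b : ℤ) % 2 = 1 := by omega
    refine Int.dvd_of_emod_eq_zero ?_
    rw [Int.add_emod, pow_two, Int.mul_emod, hodd, h1]; rfl
  have hdvd : 2 * (p : ℤ) ∣ t' ^ 2 + b :=
    IsCoprime.mul_dvd (Int.isCoprime_iff_gcd_eq_one.2 (by
      rw [← Int.odd_iff] at hpodd; simpa [Int.gcd, Int.natAbs_odd] using hpodd)) h2 ht'
  rw [hpe] at hdvd
  exact sum_three_squares_of_dvd (by omega)
    (by rw [← hpe]; have := hp.pos; omega) hdvd

/-- Part of Legendre's three-square theorem. -/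
theorem sum_three_squares {n : ℤ} (hn : 0 ≤ n)
    (h : n % 4 = 1 ∨ n % 4 = 2 ∨ n % 8 = 3) : ∃ x y z : ℤ, n = x ^ 2 + y ^ 2 + z ^ 2 := by
  lift n to ℕ using hn
  have : n % 4 = 2 ∨ n % 8 = 3 ∨ n % 8 = 1 ∨ n % 8 = 5 := by omega
  rcases this with h | h | h | h
  · exact sum_three_squares_of_two_mod_four h
  · exact sum_three_squares_of_odd_aux (c := 1) (by omega)
  · exact sum_three_squares_of_odd_aux (c := 3) (by omega)
  · exact sum_three_squares_of_odd_aux (c := 3) (by omega)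

open NumberTheorySymbols in
/-- If `n ≡ 1 [MOD 4]` is not a square, then `-n` is a nonzero square modulo some prime
`p ≡ 3 [MOD 4]`. -/
lemma exists_prime_three_mod_four_dvd_sq_add {n : ℕ} (hn : n % 4 = 1) (hsq : ¬ IsSquare n) :
    ∃ p : ℕ, p.Prime ∧ p % 4 = 3 ∧ ¬ p ∣ n ∧ ∃ t : ℤ, (p : ℤ) ∣ t ^ 2 + n := by
  obtain ⟨a, b, hab, ha⟩ := Nat.sq_mul_squarefree n
  have ha1 : a ≠ 1 := by rintro rfl; exact hsq ⟨b, by rw [← hab]; ring⟩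
  have hnodd : Odd n := Nat.odd_iff.2 (by omega)
  obtain ⟨l, hl, m, rfl⟩ := Nat.exists_prime_and_dvd ha1
  have hlm : l.Coprime m := Nat.coprime_of_squarefree_mul ha
  have hodd : Odd (l * m) := by
    rw [← hab] at hnodd; exact (Nat.odd_mul.1 hnodd).2
  have : Fact l.Prime := ⟨hl⟩
  have hl2 : l ≠ 2 := by
    rintro rfl; exact absurd (Nat.odd_mul.1 hodd).1 (by decide)
  obtain ⟨g, hg⟩ := FiniteField.exists_nonsquare (F := ZMod l) (by rwa [ZMod.ringChar_zmod_n])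
  obtain ⟨r, hr1, hr2⟩ := Nat.chineseRemainder hlm g.val 1
  have h4 : Nat.Coprime 4 (l * m) :=
    Nat.Coprime.pow_left 2 (Nat.coprime_two_left.2 hodd)
  obtain ⟨s, hs1, hs2⟩ := Nat.chineseRemainder h4 3 r
  have hg0 : g ≠ 0 := by rintro rfl; exact hg (IsSquare.zero)
  have hsl : (s : ZMod l) = g := by
    rw [← ZMod.natCast_zmod_val g, ZMod.natCast_eq_natCast_iff]
    exact (hs2.of_dvd (dvd_mul_right _ _)).trans hr1
  have hsm : s ≡ 1 [MOD m] := (hs2.of_dvd (dvd_mul_left _ _)).trans hr2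
  have hcop : s.Coprime (4 * (l * m)) := by
    refine Nat.Coprime.mul_right ?_ (Nat.Coprime.mul_right ?_ ?_)
    · have := hs1.gcd_eq; simpa [Nat.Coprime] using this
    · rw [← ZMod.isUnit_iff_coprime, hsl]; exact hg0.isUnit
    · have := hsm.gcd_eq; simpa [Nat.Coprime] using this
  obtain ⟨p, hpn, hp, hmod⟩ := Nat.forall_exists_prime_gt_and_modEq n
    (by have := hl.pos; have := hodd.pos; omega) hcop
  have : Fact p.Prime := ⟨hp⟩
  have hp4 : p % 4 = 3 := (hmod.of_dvd (dvd_mul_right _ _)).trans hs1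
  have hndvd : ¬ p ∣ n := fun h => absurd (Nat.le_of_dvd (by omega) h) (by omega)
  refine ⟨p, hp, hp4, hndvd, exists_sq_add_of_jacobiSym_neg ?_⟩
  have hJl : J(p | l) = -1 := by
    refine (ZMod.nonsquare_iff_jacobiSym_eq_neg_one (p := l)).2 ?_
    have : (p : ZMod l) = s := (ZMod.natCast_eq_natCast_iff _ _ _).2
      (hmod.of_dvd ⟨4 * m, by ring⟩)
    push_cast
    rwa [this, hsl]
  have hJm : J(p | m) = 1 := by
    rw [jacobiSym.mod_left' (a₂ := 1), jacobiSym.one_left]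
    exact_mod_cast (hmod.of_dvd ⟨4 * l, by ring⟩).trans hsm
  have hbp : p.Coprime b := (Nat.Prime.coprime_iff_not_dvd hp).2 fun h =>
    hndvd (hab ▸ (h.trans (Dvd.intro_left b (sq b).symm)).mul_right _)
  have hb0 : b ≠ 0 := by rintro rfl; simp at hab; omega
  have hJn : J(p | n) = -1 := by
    rw [← hab, jacobiSym.mul_right' _ (pow_ne_zero 2 hb0) hodd.pos.ne',
      jacobiSym.mul_right' _ hl.ne_zero (by rintro rfl; simp at hodd), jacobiSym.pow_right,
      jacobiSym.sq_one (by simpa using hbp), hJl, hJm]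
    norm_num
  rw [jacobiSym.neg _ (Nat.odd_iff.2 (by omega)), ZMod.χ₄_nat_three_mod_four hp4,
    jacobiSym.quadratic_reciprocity_one_mod_four hn (Nat.odd_iff.2 (by omega)), hJn]
  norm_num

section Quaternion

open Quaternion

/-- The integral quaternion with the given coordinates. -/
def lipschitz (a b c d : ℤ) : ℍ[ℤ] := ⟨a, b, c, d⟩

@[simp]
lemma lipschitz_re (a b c d : ℤ) : (lipschitz a b c d).re = a := rfl

@[simp]
lemma lipschitz_imI (a b c d : ℤ) : (lipschitz a b c d).imI = b := rfl

@[simp]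
lemma lipschitz_imJ (a b c d : ℤ) : (lipschitz a b c d).imJ = c := rfl

@[simp]
lemma lipschitz_imK (a b c d : ℤ) : (lipschitz a b c d).imK = d := rfl

/-- Division with remainder in the Lipschitz order by an element of odd norm. -/
lemma exists_normSq_sub_mul_lt (v q : ℍ[ℤ]) (hq : Odd (normSq q)) :
    ∃ g : ℍ[ℤ], normSq (v - g * q) < normSq q := by
  obtain ⟨m, hm⟩ : ∃ m, m = normSq q := ⟨_, rfl⟩
  have hpos : 0 < m := lt_of_le_of_ne (hm ▸ normSq_nonneg) (by
    rintro h; rw [← hm, ← h] at hq; exact absurd hq (by decide))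
  rw [← hm] at hq ⊢
  have key : ∀ b : ℤ, ∃ k : ℤ, 4 * (b + k * m) ^ 2 < m ^ 2 := fun b => by
    obtain ⟨k, hk⟩ := exists_two_mul_abs_add_mul_le hpos b
    refine ⟨k, ?_⟩
    have : 2 * |b + k * m| < m := lt_of_le_of_ne hk fun h =>
      absurd (h ▸ hq) (Int.not_odd_iff_even.2 (even_two_mul _))
    have := pow_lt_pow_left₀ this (by positivity) two_ne_zero
    rwa [mul_pow, sq_abs] at this
  obtain ⟨k1, h1⟩ := key (v * star q).re
  obtain ⟨k2, h2⟩ := key (v * star q).imI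
  obtain ⟨k3, h3⟩ := key (v * star q).imJ
  obtain ⟨k4, h4⟩ := key (v * star q).imK
  refine ⟨-lipschitz k1 k2 k3 k4, ?_⟩
  have heq : (v - -lipschitz k1 k2 k3 k4 * q) * star q
      = v * star q + m • lipschitz k1 k2 k3 k4 := by
    rw [sub_mul, mul_assoc _ q, self_mul_star, ← hm, ← coe_commutes, coe_mul_eq_smul, smul_neg,
      sub_neg_eq_add]
  have hn := congrArg normSq heq
  rw [map_mul, normSq_star, ← hm, normSq_def' (_ + _)] at hn
  simp only [re_add, imI_add, imJ_add, imK_add, re_smul, imI_smul, imJ_smul,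
    imK_smul, smul_eq_mul, lipschitz_re, lipschitz_imI, lipschitz_imJ, lipschitz_imK] at hn
  nlinarith

/-- A quaternion of even norm is carried into twice another one by some `u` of norm two. -/
lemma exists_two_smul_eq_of_even_normSq (q : ℍ[ℤ]) (hq : Even (normSq q)) :
    ∃ u q' : ℍ[ℤ], 2 * normSq q' = normSq q ∧ u * q = q' + q' := by
  rw [normSq_def'] at hq
  have h2 : (q.re + q.imI + q.imJ + q.imK) % 2 = 0 := by
    rw [← Int.even_iff]
    simpa [Int.even_add, Int.even_pow] using hq
  have main : ∀ u q' : ℍ[ℤ], normSq u = 2 → u * q = q' + q' →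
      ∃ u q' : ℍ[ℤ], 2 * normSq q' = normSq q ∧ u * q = q' + q' := fun u q' hu h => by
    refine ⟨u, q', ?_, h⟩
    have := congrArg normSq h
    rw [map_mul, hu, ← two_mul, map_mul, show (2 : ℍ[ℤ]) = ((2 : ℕ) : ℍ[ℤ]) by norm_num,
      normSq_natCast] at this
    push_cast at this
    linarith
  have hcases : (q.re - q.imI) % 2 = 0 ∨ (q.re - q.imJ) % 2 = 0 ∨ (q.re - q.imK) % 2 = 0 := by
    omega
  rcases hcases with h | h | h
  · refine main (lipschitz 1 (-1) 0 0) (lipschitz ((q.re + q.imI) / 2) ((q.imI - q.re) / 2)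
      ((q.imJ + q.imK) / 2) ((q.imK - q.imJ) / 2)) (by simp [normSq_def']) ?_
    ext <;> simp <;> omega
  · refine main (lipschitz 1 0 (-1) 0) (lipschitz ((q.re + q.imJ) / 2) ((q.imI - q.imK) / 2)
      ((q.imJ - q.re) / 2) ((q.imK + q.imI) / 2)) (by simp [normSq_def']) ?_
    ext <;> simp <;> omega
  · refine main (lipschitz 1 0 0 (-1)) (lipschitz ((q.re + q.imK) / 2) ((q.imI + q.imJ) / 2)
      ((q.imJ - q.imI) / 2) ((q.imK - q.re) / 2)) (by simp [normSq_def']) ?_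
    ext <;> simp <;> omega

/-- Left ideals of the Lipschitz order that contain an odd integer are principal. -/
lemma exists_eq_span_singleton (I : Ideal ℍ[ℤ]) {p : ℤ} (hp : Odd p)
    (hI : (Int.cast p : ℍ[ℤ]) ∈ I) :
    ∃ q ∈ I, ∀ v ∈ I, ∃ g, v = g * q := by
  have hex : ∃ n : ℕ, ∃ q ∈ I, q ≠ 0 ∧ normSq q = n := by
    refine ⟨(p ^ 2).toNat, Int.cast p, hI, ?_, ?_⟩
    · rw [Ne, ← normSq_eq_zero, normSq_intCast]
      refine pow_ne_zero _ fun h => ?_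
      rw [Int.cast_id] at h
      exact absurd (h ▸ hp) (by decide)
    · rw [normSq_intCast, Int.toNat_of_nonneg (sq_nonneg p), Int.cast_id]
  classical
  obtain ⟨q, hqI, hq0, hqn⟩ := Nat.find_spec hex
  have hmin : ∀ v ∈ I, normSq v < normSq q → v = 0 := fun v hv hlt => by
    by_contra h0
    refine Nat.find_min hex (m := (normSq v).toNat) ?_ ⟨v, hv, h0, ?_⟩
    · zify; rw [Int.toNat_of_nonneg normSq_nonneg]; omega
    · rw [Int.toNat_of_nonneg normSq_nonneg]
  have hpos : 0 < normSq q := lt_of_le_of_ne normSq_nonneg (normSq_ne_zero.2 hq0).symm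
  have hodd : Odd (normSq q) := by
    rw [← Int.not_even_iff_odd]
    intro heven
    obtain ⟨u, q', hn, hu⟩ := exists_two_smul_eq_of_even_normSq q heven
    have hq' : q' ∈ I := by
      obtain ⟨k, hk⟩ := hp
      have h1 : q' = q' * Int.cast p - Int.cast k * (u * q) := by
        rw [hu]; ext <;> simp <;> rw [hk] <;> ring
      rw [h1]
      exact I.sub_mem (I.mul_mem_left _ hI) (I.mul_mem_left _ (I.mul_mem_left _ hqI))
    have := hmin q' hq' (by omega)
    rw [this, map_zero] at hn
    omega
  refine ⟨q, hqI, fun v hv => ?_⟩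
  obtain ⟨g, hg⟩ := exists_normSq_sub_mul_lt v q hodd
  exact ⟨g, sub_eq_zero.1 (hmin _ (I.sub_mem hv (I.mul_mem_left _ hqI)) hg)⟩

/-- If `p` divides the norm of `v` but not `v` itself, then `v` has a right divisor of norm `p`. -/
lemma exists_right_divisor_normSq_eq {p : ℕ} (hp : p.Prime) (hp2 : Odd p) (v : ℍ[ℤ])
    (hv : (p : ℤ) ∣ normSq v) (hprim : ∀ r : ℍ[ℤ], v ≠ Int.cast (p : ℤ) * r) :
    ∃ q g : ℍ[ℤ], normSq q = p ∧ v = g * q := by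
  obtain ⟨q, hqI, hq⟩ := exists_eq_span_singleton (Ideal.span {v, Int.cast (p : ℤ)}) (p := p)
    (by exact_mod_cast hp2) (Ideal.subset_span (by simp))
  obtain ⟨g, hg⟩ := hq v (Ideal.subset_span (by simp))
  obtain ⟨β, hβ⟩ := hq (Int.cast (p : ℤ)) (Ideal.subset_span (by simp))
  refine ⟨q, g, ?_, hg⟩
  have hdvd : (p : ℤ) ∣ normSq q := by
    obtain ⟨x, y, rfl⟩ := Ideal.mem_span_pair.1 hqI
    rw [normSq_add, map_mul, map_mul, normSq_intCast]
    have h3 : (x * v * star (y * Int.cast (p : ℤ))).re = p * (x * v * star y).re := by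
      simp; ring
    rw [h3]
    refine dvd_add (dvd_add (hv.mul_left _) ?_) ?_
    · exact Dvd.dvd.mul_left (dvd_pow_self _ two_ne_zero) _
    · exact (dvd_mul_right _ _).mul_left _
  have hnorm := congrArg normSq hβ
  rw [map_mul, normSq_intCast] at hnorm
  have hq0 : 0 ≤ normSq q := normSq_nonneg
  obtain ⟨m, hm⟩ := Int.eq_ofNat_of_zero_le hq0
  have hmdvd : m ∣ p ^ 2 := by
    have : (m : ℤ) ∣ (p : ℤ) ^ 2 := ⟨normSq β, by rw [← hm, mul_comm]; exact hnorm⟩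
    exact_mod_cast this
  rw [hm] at hdvd hnorm ⊢
  have hp0 : (p : ℤ) ≠ 0 := by exact_mod_cast hp.ne_zero
  obtain ⟨i, hi, rfl⟩ := (Nat.dvd_prime_pow hp).1 hmdvd
  interval_cases i
  · exact absurd (Int.natCast_dvd_natCast.1 hdvd) (by simpa using hp.one_lt.ne')
  · simp
  · exfalso
    have hβ1 : normSq β = 1 := by
      push_cast at hnorm
      exact (mul_right_cancel₀ (pow_ne_zero 2 hp0) (by rw [one_mul]; exact hnorm)).symm
    have hqβ : q = Int.cast (p : ℤ) * star β := by
      rw [(Int.cast_commute (p : ℤ) (star β)).eq, hβ, ← mul_assoc, star_mul_self, hβ1, coe_one,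
        one_mul]
    refine hprim (g * star β) ?_
    rw [hg, hqβ, ← mul_assoc, ← mul_assoc, (Int.cast_commute (p : ℤ) g).eq]

lemma parity_of_sum_four_squares {a b c d : ℤ} (h : (a ^ 2 + b ^ 2 + c ^ 2 + d ^ 2) % 4 = 3) :
    Odd (b * c + a * d) ∧ Odd (a ^ 2 - b ^ 2 + c ^ 2 - d ^ 2) := by
  have key : ∀ m : ℤ, (Even m ∧ m ^ 2 % 4 = 0) ∨ (¬ Even m ∧ m ^ 2 % 4 = 1) := fun m => by
    rcases Int.even_or_odd m with ⟨k, rfl⟩ | ⟨k, rfl⟩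
    · left; exact ⟨⟨k, rfl⟩, by ring_nf; omega⟩
    · right; exact ⟨by simp, by ring_nf; omega⟩
  simp only [← Int.not_even_iff_odd, Int.even_add, Int.even_sub, Int.even_mul, Int.even_pow]
  rcases key a with ⟨ha, ha'⟩ | ⟨ha, ha'⟩ <;> rcases key b with ⟨hb, hb'⟩ | ⟨hb, hb'⟩ <;>
  rcases key c with ⟨hc, hc'⟩ | ⟨hc, hc'⟩ <;> rcases key d with ⟨hd, hd'⟩ | ⟨hd, hd'⟩ <;>
  first | omega | simp [ha, hb, hc, hd]

/-- A rotation by a quaternion whose norm is a prime `p ≡ 3 [MOD 4]` exchanges the two kinds of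
representations of a nonsquare `n` by `x² + 4 y² + 4 z²`. -/
theorem exists_representation_of_other_parity {n : ℕ} (hsq : ¬ IsSquare n) {x y z : ℤ}
    (hx : x % 2 = 1) (h : (n : ℤ) = x ^ 2 + 4 * y ^ 2 + 4 * z ^ 2) :
    ∃ x' y' z' : ℤ, (n : ℤ) = x' ^ 2 + 4 * y' ^ 2 + 4 * z' ^ 2 ∧ (y' - y) % 2 = 1 := by
  have hn : n % 4 = 1 := by
    have : x ^ 2 % 4 = 1 := by
      obtain ⟨k, rfl⟩ : ∃ k, x = 2 * k + 1 := ⟨x / 2, by omega⟩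
      ring_nf; omega
    omega
  obtain ⟨p, hp, hp4, hpn, t, ht⟩ := exists_prime_three_mod_four_dvd_sq_add hn hsq
  have hp0 : (p : ℤ) ≠ 0 := by exact_mod_cast hp.ne_zero
  obtain ⟨q, g, hqp, hg⟩ := exists_right_divisor_normSq_eq hp (Nat.odd_iff.2 (by omega))
    (lipschitz t x (2 * y) (2 * z))
    (by rw [normSq_def']; simp only [lipschitz_re, lipschitz_imI, lipschitz_imJ, lipschitz_imK]
        convert ht using 1; rw [h]; ring)
    (by
      intro r hr
      apply hpn
      have h1 := congrArg QuaternionAlgebra.imI hr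
      have h2 := congrArg QuaternionAlgebra.imJ hr
      have h3 := congrArg QuaternionAlgebra.imK hr
      simp at h1 h2 h3
      zify
      refine ⟨x * r.imI + 2 * y * r.imJ + 2 * z * r.imK, ?_⟩
      rw [h]
      linear_combination x * h1 + 2 * y * h2 + 2 * z * h3)
  obtain ⟨w, hw⟩ : ∃ w, w = q * g - Int.cast t := ⟨_, rfl⟩
  have hrot : (Int.cast (p : ℤ) : ℍ[ℤ]) * w = q * lipschitz 0 x (2 * y) (2 * z) * star q := by
    have h0 : lipschitz 0 x (2 * y) (2 * z) = g * q - Int.cast t := by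
      rw [← hg]; ext <;> simp
    have h1 : q * lipschitz 0 x (2 * y) (2 * z) = w * q := by
      rw [h0, hw, mul_sub, sub_mul, mul_assoc, (Int.cast_commute t q).eq]
    rw [h1, mul_assoc, self_mul_star, hqp, ← coe_commutes]
    rfl
  have hnorm : normSq w = n := by
    have := congrArg normSq hrot
    rw [map_mul, map_mul, map_mul, normSq_star, normSq_intCast, hqp] at this
    have h2 : normSq (lipschitz 0 x (2 * y) (2 * z)) = n := by
      rw [normSq_def', h]; simp; ring
    rw [h2] at this
    refine mul_left_cancel₀ (pow_ne_zero 2 hp0) ?_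
    rw [Int.cast_id] at this
    linear_combination this
  have e0 := congrArg QuaternionAlgebra.re hrot
  have e2 := congrArg QuaternionAlgebra.imJ hrot
  have e3 := congrArg QuaternionAlgebra.imK hrot
  have hp2 : ¬ Even (p : ℤ) := by rw [Int.not_even_iff]; omega
  have hw0 : w.re = 0 := by
    refine (mul_eq_zero.1 (?_ : (p : ℤ) * w.re = 0)).resolve_left hp0
    simp at e0
    rw [e0]; ring
  simp at e2 e3
  rw [normSq_def'] at hqp
  obtain ⟨hcd, had⟩ := parity_of_sum_four_squares (a := q.re) (b := q.imI) (c := q.imJ)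
    (d := q.imK) (by omega)
  have f2 : p * w.imJ = 2 * ((q.imI * q.imJ + q.re * q.imK) * x
      + 2 * ((q.imJ * q.imK - q.re * q.imI) * z)
      + (q.re ^ 2 - q.imI ^ 2 + q.imJ ^ 2 - q.imK ^ 2) * y) := by
    rw [e2]; ring
  have f3 : p * w.imK = 2 * ((q.imI * q.imK - q.re * q.imJ) * x
      + 2 * ((q.imJ * q.imK + q.re * q.imI) * y)
      + (q.re ^ 2 - q.imI ^ 2 - q.imJ ^ 2 + q.imK ^ 2) * z) := by
    rw [e3]; ring
  obtain ⟨y', hy'⟩ : Even w.imJ :=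
    (Int.even_mul.1 (f2 ▸ even_two_mul _)).resolve_left hp2
  obtain ⟨z', hz'⟩ : Even w.imK :=
    (Int.even_mul.1 (f3 ▸ even_two_mul _)).resolve_left hp2
  refine ⟨w.imI, y', z', ?_, ?_⟩
  · rw [← hnorm, normSq_def', hw0, hy', hz']; ring
  · rw [hy'] at f2
    have f : p * y' = (q.imI * q.imJ + q.re * q.imK) * x
        + 2 * ((q.imJ * q.imK - q.re * q.imI) * z)
        + (q.re ^ 2 - q.imI ^ 2 + q.imJ ^ 2 - q.imK ^ 2) * y := by linarith
    have hpar := iff_of_eq (congrArg Even f)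
    rw [← Int.not_even_iff_odd] at hcd had
    have hx' : ¬ Even x := by rw [Int.not_even_iff]; exact hx
    rw [Int.even_mul, Int.even_add, Int.even_add, Int.even_mul (n := x), Int.even_mul (m := 2),
      Int.even_mul (n := y)] at hpar
    simp only [hp2, hcd, had, hx', even_two, false_or, true_or, false_iff, not_true_eq_false]
      at hpar
    rw [Int.even_iff, Int.even_iff] at hpar
    omega

end Quaternion

lemma sq_emod_sixteen (u : ℤ) : (u % 4 = 0 ∧ u ^ 2 % 16 = 0) ∨ (u % 4 = 2 ∧ u ^ 2 % 16 = 4) ∨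
    ((u % 8 = 1 ∨ u % 8 = 7) ∧ u ^ 2 % 16 = 1) ∨ ((u % 8 = 3 ∨ u % 8 = 5) ∧ u ^ 2 % 16 = 9) := by
  have h : u ^ 2 % 16 = (u % 8) ^ 2 % 16 := by
    conv_lhs => rw [← Int.emod_add_mul_ediv u 8]
    ring_nf
    omega
  have h1 := Int.emod_nonneg u (show (8 : ℤ) ≠ 0 by decide)
  have h2 := Int.emod_lt_of_pos u (show (0 : ℤ) < 8 by decide)
  rw [h]
  obtain ⟨r, hr⟩ : ∃ r, r = u % 8 := ⟨_, rfl⟩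
  rw [← hr] at h1 h2 ⊢
  interval_cases r <;> omega

lemma sq_emod_three (u : ℤ) : (u % 3 = 0 ∧ u ^ 2 % 3 = 0) ∨
    ((u % 3 = 1 ∨ u % 3 = 2) ∧ u ^ 2 % 3 = 1) := by
  have : u % 3 = 0 ∨ u % 3 = 1 ∨ u % 3 = 2 := by omega
  rcases this with h | h | h <;> simp [h, pow_two, Int.mul_emod]

lemma sq_emod_five (u : ℤ) : (u % 5 = 0 ∧ u ^ 2 % 5 = 0) ∨
    ((u % 5 = 1 ∨ u % 5 = 4) ∧ u ^ 2 % 5 = 1) ∨ ((u % 5 = 2 ∨ u % 5 = 3) ∧ u ^ 2 % 5 = 4) := by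
  have : u % 5 = 0 ∨ u % 5 = 1 ∨ u % 5 = 2 ∨ u % 5 = 3 ∨ u % 5 = 4 := by omega
  rcases this with h | h | h | h | h <;> simp [h, pow_two, Int.mul_emod]

lemma sum_sq_eq_two_mul {x y : ℤ} (h : (x - y) % 2 = 0) :
    ∃ p q : ℤ, x = p + q ∧ y = p - q ∧ x ^ 2 + y ^ 2 = 2 * p ^ 2 + 2 * q ^ 2 := by
  obtain ⟨q, hq⟩ := Int.dvd_of_emod_eq_zero h
  obtain rfl : x = y + 2 * q := by linarith
  exact ⟨y + q, q, by ring, by ring, by ring⟩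

lemma sum_odd_sq_eq {x y : ℤ} (hx : x % 2 = 1) (hy : y % 2 = 1) :
    ∃ p q : ℤ, p % 2 = 1 ∧ x ^ 2 + y ^ 2 = 2 * p ^ 2 + 8 * q ^ 2 := by
  obtain ⟨p, q, h1, h2, h⟩ := sum_sq_eq_two_mul (x := x) (y := y) (by omega)
  rcases Int.emod_two_eq_zero_or_one q with h0 | h0
  · exact ⟨p, q / 2, by omega, by
      rw [h]; obtain ⟨k, rfl⟩ := Int.dvd_of_emod_eq_zero h0; simp; ring⟩
  · exact ⟨q, p / 2, by omega, by
      rw [h]; obtain ⟨k, rfl⟩ := Int.dvd_of_emod_eq_zero (show p % 2 = 0 by omega); simp; ring⟩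

lemma eq_of_one_mod_four {n : ℤ} (hn : 0 ≤ n) (h : n % 4 = 1) :
    ∃ x y z : ℤ, x % 2 = 1 ∧ n = x ^ 2 + 4 * y ^ 2 + 4 * z ^ 2 := by
  obtain ⟨x, y, z, rfl⟩ := sum_three_squares hn (by omega)
  have main : ∀ a b c : ℤ, a % 2 = 1 → b % 2 = 0 → c % 2 = 0 →
      a ^ 2 + b ^ 2 + c ^ 2 = x ^ 2 + y ^ 2 + z ^ 2 →
      ∃ x' y' z' : ℤ, x' % 2 = 1 ∧
        x ^ 2 + y ^ 2 + z ^ 2 = x' ^ 2 + 4 * y' ^ 2 + 4 * z' ^ 2 := by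
    intro a b c ha hb hc habc
    obtain ⟨b, rfl⟩ := Int.dvd_of_emod_eq_zero hb
    obtain ⟨c, rfl⟩ := Int.dvd_of_emod_eq_zero hc
    exact ⟨a, b, c, ha, by rw [← habc]; ring⟩
  have hx := sq_emod_sixteen x
  have hy := sq_emod_sixteen y
  have hz := sq_emod_sixteen z
  have : (x % 2 = 1 ∧ y % 2 = 0 ∧ z % 2 = 0) ∨ (y % 2 = 1 ∧ x % 2 = 0 ∧ z % 2 = 0) ∨
    (z % 2 = 1 ∧ x % 2 = 0 ∧ y % 2 = 0) := by omega
  rcases this with ⟨h1, h2, h3⟩ | ⟨h1, h2, h3⟩ | ⟨h1, h2, h3⟩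
  · exact main x y z h1 h2 h3 rfl
  · exact main y x z h1 h2 h3 (by ring)
  · exact main z x y h1 h2 h3 (by ring)

lemma eq_of_two_mod_four {n : ℤ} (hn : 0 ≤ n) (h : n % 4 = 2) :
    ∃ x y z : ℤ, x % 2 = 1 ∧ y % 2 = 1 ∧ n = x ^ 2 + y ^ 2 + 4 * z ^ 2 := by
  obtain ⟨x, y, z, rfl⟩ := sum_three_squares hn (by omega)
  have main : ∀ a b c : ℤ, a % 2 = 1 → b % 2 = 1 → c % 2 = 0 →
      a ^ 2 + b ^ 2 + c ^ 2 = x ^ 2 + y ^ 2 + z ^ 2 →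
      ∃ x' y' z' : ℤ, x' % 2 = 1 ∧ y' % 2 = 1 ∧
        x ^ 2 + y ^ 2 + z ^ 2 = x' ^ 2 + y' ^ 2 + 4 * z' ^ 2 := by
    intro a b c ha hb hc habc
    obtain ⟨c, rfl⟩ := Int.dvd_of_emod_eq_zero hc
    exact ⟨a, b, c, ha, hb, by rw [← habc]; ring⟩
  have hx := sq_emod_sixteen x
  have hy := sq_emod_sixteen y
  have hz := sq_emod_sixteen z
  have : (x % 2 = 1 ∧ y % 2 = 1 ∧ z % 2 = 0) ∨ (x % 2 = 1 ∧ z % 2 = 1 ∧ y % 2 = 0) ∨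
    (y % 2 = 1 ∧ z % 2 = 1 ∧ x % 2 = 0) := by omega
  rcases this with ⟨h1, h2, h3⟩ | ⟨h1, h2, h3⟩ | ⟨h1, h2, h3⟩
  · exact main x y z h1 h2 h3 rfl
  · exact main x z y h1 h2 h3 (by ring)
  · exact main y z x h1 h2 h3 (by ring)

lemma eq_of_three_mod_eight {n : ℤ} (hn : 0 ≤ n) (h : n % 8 = 3) :
    ∃ x y z : ℤ, x % 2 = 1 ∧ y % 2 = 1 ∧ z % 2 = 1 ∧ n = x ^ 2 + y ^ 2 + z ^ 2 := by
  obtain ⟨x, y, z, rfl⟩ := sum_three_squares hn (by omega)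
  have hx := sq_emod_sixteen x
  have hy := sq_emod_sixteen y
  have hz := sq_emod_sixteen z
  exact ⟨x, y, z, by omega, by omega, by omega, rfl⟩

lemma eq_of_five_mod_eight {n : ℤ} (hn : 0 ≤ n) (h : n % 8 = 5) :
    ∃ x y z : ℤ, x % 2 = 1 ∧ y % 2 = 1 ∧ n = x ^ 2 + 4 * y ^ 2 + 16 * z ^ 2 := by
  obtain ⟨x, y, z, hx, rfl⟩ := eq_of_one_mod_four hn (by omega)
  have hx' := sq_emod_sixteen x
  have hy := sq_emod_sixteen y
  have hz := sq_emod_sixteen z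
  rcases Int.emod_two_eq_zero_or_one z with h0 | h0
  · obtain ⟨k, rfl⟩ := Int.dvd_of_emod_eq_zero h0
    exact ⟨x, y, k, hx, by omega, by ring⟩
  · obtain ⟨k, rfl⟩ := Int.dvd_of_emod_eq_zero (show y % 2 = 0 by omega)
    exact ⟨x, z, k, hx, by omega, by ring⟩

lemma eq_sq_add_sq_add_two_mul_sq {n : ℤ} (hn : 0 ≤ n) (h : n % 2 = 1 ∨ n % 8 = 2) :
    ∃ x y z : ℤ, n = x ^ 2 + y ^ 2 + 2 * z ^ 2 := by
  rcases h with h | h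
  · obtain ⟨x, y, z, hx, hy, h⟩ := eq_of_two_mod_four (n := 2 * n) (by omega) (by omega)
    obtain ⟨p, q, -, -, hpq⟩ := sum_sq_eq_two_mul (x := x) (y := y) (by omega)
    exact ⟨p, q, z, by linarith⟩
  · obtain ⟨k, rfl⟩ := Int.dvd_of_emod_eq_zero (show n % 2 = 0 by omega)
    obtain ⟨x, y, z, hxyz⟩ := sum_three_squares (n := k) (by omega) (by omega)
    exact ⟨x + y, x - y, z, by rw [hxyz]; ring⟩

lemma eq_sq_add_two_mul_sq_add_three_mul_sq {n : ℤ} (hn : 0 ≤ n) (h : n % 2 = 1 ∨ n % 8 = 6) :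
    ∃ x y z : ℤ, n = x ^ 2 + 2 * y ^ 2 + 3 * z ^ 2 := by
  by_cases h3 : n % 3 = 0
  · obtain ⟨k, rfl⟩ := Int.dvd_of_emod_eq_zero h3
    obtain ⟨u, v, w, rfl⟩ := eq_sq_add_sq_add_two_mul_sq (n := k) (by omega) (by omega)
    exact ⟨u + 2 * w, u - w, v, by ring⟩
  · obtain ⟨u, v, w, huvw⟩ := eq_sq_add_sq_add_two_mul_sq (n := 3 * n) (by omega) (by omega)
    have main : ∀ u v w : ℤ, v % 3 = 0 → (u - w) % 3 = 0 → 3 * n = u ^ 2 + v ^ 2 + 2 * w ^ 2 →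
        ∃ x y z : ℤ, n = x ^ 2 + 2 * y ^ 2 + 3 * z ^ 2 := by
      intro u v w hv huw heq
      obtain ⟨z, rfl⟩ := Int.dvd_of_emod_eq_zero hv
      obtain ⟨y, hy⟩ := Int.dvd_of_emod_eq_zero huw
      obtain rfl : u = w + 3 * y := by linarith
      exact ⟨w + y, y, z, by linarith⟩
    have hu := sq_emod_three u
    have hv := sq_emod_three v
    have hw := sq_emod_three w
    have h9 : ¬ (u % 3 = 0 ∧ v % 3 = 0 ∧ w % 3 = 0) := by
      rintro ⟨h1, h2, h3⟩
      obtain ⟨a, rfl⟩ := Int.dvd_of_emod_eq_zero h1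
      obtain ⟨b, rfl⟩ := Int.dvd_of_emod_eq_zero h2
      obtain ⟨c, rfl⟩ := Int.dvd_of_emod_eq_zero h3
      ring_nf at huvw
      omega
    have : (v % 3 = 0 ∧ (u - w) % 3 = 0) ∨ (v % 3 = 0 ∧ (u - -w) % 3 = 0) ∨
      (u % 3 = 0 ∧ (v - w) % 3 = 0) ∨ (u % 3 = 0 ∧ (v - -w) % 3 = 0) := by omega
    rcases this with ⟨h1, h2⟩ | ⟨h1, h2⟩ | ⟨h1, h2⟩ | ⟨h1, h2⟩
    · exact main u v w h1 h2 huvw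
    · exact main u v (-w) h1 h2 (by rw [huvw]; ring)
    · exact main v u w h1 h2 (by rw [huvw]; ring)
    · exact main v u (-w) h1 h2 (by rw [huvw]; ring)

lemma eq_sq_add_two_mul_sq_add_six_mul_sq {n : ℤ} (hn : 0 ≤ n) (h : n % 4 = 3) :
    ∃ x y z : ℤ, n = x ^ 2 + 2 * y ^ 2 + 6 * z ^ 2 := by
  obtain ⟨x, y, z, hxyz⟩ :=
    eq_sq_add_two_mul_sq_add_three_mul_sq (n := 2 * n) (by omega) (by omega)
  have main : ∀ z' : ℤ, (x - z') % 4 = 0 → z' ^ 2 = z ^ 2 →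
      ∃ x y z : ℤ, n = x ^ 2 + 2 * y ^ 2 + 6 * z ^ 2 := by
    intro z' hz' hz
    obtain ⟨k, hk⟩ := Int.dvd_of_emod_eq_zero hz'
    obtain rfl : x = z' + 4 * k := by linarith
    exact ⟨y, z' + k, k, by rw [← hz] at hxyz; linarith⟩
  have hx := sq_emod_sixteen x
  have hy := sq_emod_sixteen y
  have hz := sq_emod_sixteen z
  have : (x % 2 = 0 ∧ z % 2 = 0) ∨ (x - z) % 4 = 0 ∨ (x - -z) % 4 = 0 := by omega
  rcases this with ⟨h1, h2⟩ | h1 | h1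
  · obtain ⟨x, rfl⟩ := Int.dvd_of_emod_eq_zero h1
    obtain ⟨z, rfl⟩ := Int.dvd_of_emod_eq_zero h2
    exact ⟨y, x, z, by linarith⟩
  · exact main z h1 rfl
  · exact main (-z) h1 (by ring)

lemma eq_sq_add_sq_add_five_mul_sq {n : ℤ} (hn : 0 ≤ n) (h : n % 8 = 7) :
    ∃ x y z : ℤ, n = x ^ 2 + y ^ 2 + 5 * z ^ 2 := by
  obtain ⟨u, v, w, huvw⟩ := sum_three_squares (n := 5 * n) (by omega) (by omega)
  have main : ∀ u v w : ℤ, w % 5 = 0 → (u + 2 * v) % 5 = 0 → 5 * n = u ^ 2 + v ^ 2 + w ^ 2 →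
      ∃ x y z : ℤ, n = x ^ 2 + y ^ 2 + 5 * z ^ 2 := by
    intro u v w hw huv heq
    obtain ⟨z, rfl⟩ := Int.dvd_of_emod_eq_zero hw
    obtain ⟨x, hx⟩ := Int.dvd_of_emod_eq_zero huv
    obtain rfl : u = 5 * x - 2 * v := by linarith
    exact ⟨x, 2 * x - v, z, by linarith⟩
  have hu := sq_emod_five u
  have hv := sq_emod_five v
  have hw := sq_emod_five w
  have : (w % 5 = 0 ∧ ((u + 2 * v) % 5 = 0 ∨ (u + 2 * -v) % 5 = 0)) ∨
      (v % 5 = 0 ∧ ((u + 2 * w) % 5 = 0 ∨ (u + 2 * -w) % 5 = 0)) ∨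
      (u % 5 = 0 ∧ ((v + 2 * w) % 5 = 0 ∨ (v + 2 * -w) % 5 = 0)) := by omega
  rcases this with ⟨h1, h2 | h2⟩ | ⟨h1, h2 | h2⟩ | ⟨h1, h2 | h2⟩
  · exact main u v w h1 h2 huvw
  · exact main u (-v) w h1 h2 (by rw [huvw]; ring)
  · exact main u w v h1 h2 (by rw [huvw]; ring)
  · exact main u (-w) v h1 h2 (by rw [huvw]; ring)
  · exact main v w u h1 h2 (by rw [huvw]; ring)
  · exact main v (-w) u h1 h2 (by rw [huvw]; ring)

lemma eq_of_one_mod_eight_of_not_isSquare {n : ℕ} (h : n % 8 = 1) (hsq : ¬ IsSquare n) (r : ℤ) :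
    ∃ x y z : ℤ, (n : ℤ) = x ^ 2 + 4 * y ^ 2 + 4 * z ^ 2 ∧ (y - r) % 2 = 0 ∧ (z - r) % 2 = 0 := by
  obtain ⟨x, y, z, hx, hxyz⟩ := eq_of_one_mod_four (n := n) (by omega) (by omega)
  have key : ∀ x y z : ℤ, (n : ℤ) = x ^ 2 + 4 * y ^ 2 + 4 * z ^ 2 → (y - z) % 2 = 0 := by
    intro x y z h'
    have hx := sq_emod_sixteen x
    have hy := sq_emod_sixteen y
    have hz := sq_emod_sixteen z
    omega
  by_cases hy : (y - r) % 2 = 0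
  · exact ⟨x, y, z, hxyz, hy, by have := key x y z hxyz; omega⟩
  · obtain ⟨x', y', z', hxyz', hy'⟩ := exists_representation_of_other_parity hsq hx hxyz
    exact ⟨x', y', z', hxyz', by omega, by have := key x' y' z' hxyz'; omega⟩

lemma sq_eq_of_three_mod_four {r : ℤ} (hr : 0 ≤ r) (h : r % 4 = 3) :
    ∃ x y z : ℤ, y % 2 = 1 ∧ r ^ 2 = x ^ 2 + 8 * y ^ 2 + 8 * z ^ 2 := by
  obtain ⟨a, b, c, d, habcd⟩ := Nat.sum_four_squares r.toNat
  zify at habcd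
  rw [Int.toNat_of_nonneg hr] at habcd
  obtain ⟨a, b, c, d, rfl⟩ : ∃ a b c d : ℤ, a ^ 2 + b ^ 2 + c ^ 2 + d ^ 2 = r :=
    ⟨_, _, _, _, habcd⟩
  obtain ⟨h1, -⟩ := parity_of_sum_four_squares h
  have h1' := Int.odd_iff.1 h1
  have key : (a ^ 2 + b ^ 2 + c ^ 2 + d ^ 2) ^ 2 = (a ^ 2 + b ^ 2 - c ^ 2 - d ^ 2) ^ 2
      + 4 * ((b * c + a * d) ^ 2 + (b * d - a * c) ^ 2) := by ring
  have h2' : (b * d - a * c) % 2 = 1 := by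
    have h2 := (parity_of_sum_four_squares (a := a) (b := b) (c := d) (d := -c)
      (by rw [← h]; ring_nf)).1
    rw [← Int.odd_iff]
    convert h2 using 1
    ring
  obtain ⟨p, q, hp, hpq⟩ := sum_odd_sq_eq h1' h2'
  exact ⟨a ^ 2 + b ^ 2 - c ^ 2 - d ^ 2, p, 2 * q, hp, by rw [key, hpq]; ring⟩

lemma sq_eq_of_one_mod_four {r : ℤ} (hr : 1 < r) (h : r % 4 = 1) :
    ∃ x y z : ℤ, y % 2 = 1 ∧ r ^ 2 = x ^ 2 + 8 * y ^ 2 + 8 * z ^ 2 := by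
  obtain ⟨a, m, ha, hm, hm0, rfl⟩ : ∃ a m : ℤ, a % 2 = 1 ∧ (m % 4 = 2 ∨ m % 4 = 1) ∧ 0 ≤ m ∧
      r = a ^ 2 + 4 * m := by
    have : r % 16 = 5 ∨ r % 16 = 9 ∨ r % 16 = 1 ∨ r % 16 = 13 := by omega
    rcases this with h | h | h | h
    · exact ⟨1, (r - 1) / 4, by omega, by omega, by omega, by omega⟩
    · exact ⟨1, (r - 1) / 4, by omega, by omega, by omega, by omega⟩
    · exact ⟨3, (r - 9) / 4, by omega, by omega, by omega, by omega⟩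
    · exact ⟨3, (r - 9) / 4, by omega, by omega, by omega, by omega⟩
  have main : ∀ b c d : ℤ, c % 2 = 1 → m = b ^ 2 + c ^ 2 + 4 * d ^ 2 →
      ∃ x y z : ℤ, y % 2 = 1 ∧ (a ^ 2 + 4 * m) ^ 2 = x ^ 2 + 8 * y ^ 2 + 8 * z ^ 2 := by
    rintro b c d hc rfl
    refine ⟨a ^ 2 + 4 * b ^ 2 - 4 * c ^ 2 - 16 * d ^ 2,
      2 * (b * c + a * d + 2 * b * d) - a * c, 2 * (b * c + a * d - 2 * b * d) + a * c, ?_, by ring⟩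
    rw [Int.sub_emod, Int.mul_emod_right, Int.mul_emod, ha, hc]
    rfl
  rcases hm with hm | hm
  · obtain ⟨b, c, d, -, hc, h⟩ := eq_of_two_mod_four hm0 hm
    exact main b c d hc h
  · obtain ⟨c, b, d, hc, h⟩ := eq_of_one_mod_four hm0 hm
    exact main (2 * b) c d hc (by rw [h]; ring)

lemma eq_sq_add_eight_mul_sq_add_eight_mul_sq {n : ℤ} (hn : 1 < n) (h : n % 8 = 1) :
    ∃ x y z : ℤ, y % 2 = 1 ∧ n = x ^ 2 + 8 * y ^ 2 + 8 * z ^ 2 := by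
  lift n to ℕ using by omega
  by_cases hsq : IsSquare n
  · obtain ⟨r, rfl⟩ := hsq
    have hr1 : 1 < (r : ℤ) := by by_contra! hr; push_cast at hn; nlinarith
    have hr := sq_emod_sixteen r
    push_cast at h hn ⊢
    rw [← pow_two] at h ⊢
    have : (r : ℤ) % 4 = 1 ∨ (r : ℤ) % 4 = 3 := by omega
    rcases this with h4 | h4
    · exact sq_eq_of_one_mod_four hr1 h4
    · exact sq_eq_of_three_mod_four (by omega) h4
  · obtain ⟨x, y, z, hxyz, hy, hz⟩ := eq_of_one_mod_eight_of_not_isSquare (by omega) hsq 1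
    obtain ⟨p, q, hp, hpq⟩ := sum_odd_sq_eq (x := y) (y := z) (by omega) (by omega)
    exact ⟨x, p, 2 * q, hp, by linear_combination hxyz + 4 * hpq⟩

lemma eq_sq_add_four_mul_sq_add_sixteen_mul_sq {n : ℤ} (hn : 0 ≤ n) (h : n % 4 = 1) :
    ∃ x y z : ℤ, x % 2 = 1 ∧ n = x ^ 2 + 4 * y ^ 2 + 16 * z ^ 2 := by
  have : n % 8 = 5 ∨ n % 8 = 1 := by omega
  rcases this with h8 | h8
  · obtain ⟨x, y, z, hx, -, hxyz⟩ := eq_of_five_mod_eight hn h8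
    exact ⟨x, y, z, hx, hxyz⟩
  lift n to ℕ using hn
  by_cases hsq : IsSquare n
  · obtain ⟨r, rfl⟩ := hsq
    have hr := sq_emod_sixteen r
    push_cast at h ⊢
    rw [← pow_two] at h ⊢
    exact ⟨r, 0, 0, by omega, by ring⟩
  · obtain ⟨x, y, z, hxyz, hy, hz⟩ := eq_of_one_mod_eight_of_not_isSquare (by omega) hsq 0
    obtain ⟨k, rfl⟩ := Int.dvd_of_emod_eq_zero (show z % 2 = 0 by omega)
    have hx := sq_emod_sixteen x
    exact ⟨x, y, k, by omega, by rw [hxyz]; ring⟩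

lemma two_mul_triZ (k : ℤ) : 2 * triZ k = k * (k + 1) :=
  Int.mul_ediv_cancel' (Int.even_mul_succ_self k).two_dvd

lemma exists_of_eight_mul_eq {n a b c x y z : ℤ} (hy : y % 2 = 1) (hz : z % 2 = 1)
    (h : 8 * n + b + c = 8 * a * x ^ 2 + b * y ^ 2 + c * z ^ 2) :
    ∃ x y z : ℤ, n = a * x ^ 2 + b * triZ y + c * triZ z := by
  obtain ⟨u, rfl⟩ : ∃ u, y = 2 * u + 1 := ⟨y / 2, by omega⟩
  obtain ⟨v, rfl⟩ : ∃ v, z = 2 * v + 1 := ⟨z / 2, by omega⟩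
  refine ⟨x, u, v, mul_left_cancel₀ (show (8 : ℤ) ≠ 0 by decide) ?_⟩
  linear_combination h - 4 * b * two_mul_triZ u - 4 * c * two_mul_triZ v

lemma exists_eq_of_one_one_one {n : ℤ} (hn : 0 ≤ n) :
    ∃ x y z : ℤ, n = 1 * x ^ 2 + 1 * triZ y + 1 * triZ z := by
  obtain ⟨s, r, x, hs, h⟩ := eq_of_one_mod_four (n := 4 * n + 1) (by omega) (by omega)
  exact exists_of_eight_mul_eq (x := x) (y := s + 2 * r) (z := s - 2 * r) (by omega) (by omega)
    (by linear_combination 2 * h)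

lemma exists_eq_of_one_two_one {n : ℤ} (hn : 0 ≤ n) :
    ∃ x y z : ℤ, n = 1 * x ^ 2 + 2 * triZ y + 1 * triZ z := by
  obtain ⟨r, s, z, hr, hs, hz, h⟩ := eq_of_three_mod_eight (n := 8 * n + 3) (by omega) (by omega)
  obtain ⟨p, q, hp, hpq⟩ := sum_odd_sq_eq hr hs
  exact exists_of_eight_mul_eq (x := q) hp hz (by linear_combination h + hpq)

lemma exists_eq_of_one_two_two {n : ℤ} (hn : 0 ≤ n) :
    ∃ x y z : ℤ, n = 1 * x ^ 2 + 2 * triZ y + 2 * triZ z := by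
  obtain ⟨y, z, x, hy, hz, h⟩ := eq_of_two_mod_four (n := 4 * n + 2) (by omega) (by omega)
  exact exists_of_eight_mul_eq (x := x) hy hz (by linear_combination 2 * h)

lemma exists_eq_of_one_three_one {n : ℤ} (hn : 0 ≤ n) :
    ∃ x y z : ℤ, n = 1 * x ^ 2 + 3 * triZ y + 1 * triZ z := by
  obtain ⟨x, y, w, h⟩ := eq_sq_add_two_mul_sq_add_three_mul_sq (n := 2 * n + 1) (by omega)
    (by omega)
  have h1 := sq_emod_sixteen x
  have h2 := sq_emod_sixteen w
  exact exists_of_eight_mul_eq (x := y) (y := w - x) (z := x + 3 * w) (by omega) (by omega)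
    (by linear_combination 4 * h)

lemma exists_eq_of_one_four_one {n : ℤ} (hn : 0 ≤ n) :
    ∃ x y z : ℤ, n = 1 * x ^ 2 + 4 * triZ y + 1 * triZ z := by
  obtain ⟨r, s, t, h⟩ := eq_sq_add_sq_add_two_mul_sq (n := 8 * n + 5) (by omega) (by omega)
  have h1 := sq_emod_sixteen r
  have h2 := sq_emod_sixteen s
  have h3 := sq_emod_sixteen t
  obtain ⟨x, rfl⟩ : ∃ x, t = 2 * x := ⟨t / 2, by omega⟩
  rcases Int.emod_two_eq_zero_or_one r with hr | hr
  · obtain ⟨y, rfl⟩ : ∃ y, r = 2 * y := ⟨r / 2, by omega⟩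
    exact exists_of_eight_mul_eq (x := x) (y := y) (z := s) (by omega) (by omega)
      (by linear_combination h)
  · obtain ⟨y, rfl⟩ : ∃ y, s = 2 * y := ⟨s / 2, by omega⟩
    exact exists_of_eight_mul_eq (x := x) (y := y) (z := r) (by omega) (by omega)
      (by linear_combination h)

lemma exists_eq_of_one_four_two {n : ℤ} (hn : 0 ≤ n) :
    ∃ x y z : ℤ, n = 1 * x ^ 2 + 4 * triZ y + 2 * triZ z := by
  obtain ⟨r, s, t, h⟩ := eq_sq_add_sq_add_two_mul_sq (n := 4 * n + 3) (by omega) (by omega)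
  have h1 := sq_emod_sixteen r
  have h2 := sq_emod_sixteen s
  have h3 := sq_emod_sixteen t
  rcases Int.emod_two_eq_zero_or_one r with hr | hr
  · obtain ⟨x, rfl⟩ : ∃ x, r = 2 * x := ⟨r / 2, by omega⟩
    exact exists_of_eight_mul_eq (x := x) (y := t) (z := s) (by omega) (by omega)
      (by linear_combination 2 * h)
  · obtain ⟨x, rfl⟩ : ∃ x, s = 2 * x := ⟨s / 2, by omega⟩
    exact exists_of_eight_mul_eq (x := x) (y := t) (z := r) (by omega) (by omega)
      (by linear_combination 2 * h)

lemma exists_eq_of_one_five_two {n : ℤ} (hn : 0 ≤ n) :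
    ∃ x y z : ℤ, n = 1 * x ^ 2 + 5 * triZ y + 2 * triZ z := by
  obtain ⟨r, s, t, h⟩ := eq_sq_add_sq_add_five_mul_sq (n := 8 * n + 7) (by omega) (by omega)
  have h1 := sq_emod_sixteen r
  have h2 := sq_emod_sixteen s
  have h3 := sq_emod_sixteen t
  obtain ⟨p, q, hp, hpq⟩ := sum_odd_sq_eq (x := r) (y := s) (by omega) (by omega)
  exact exists_of_eight_mul_eq (x := q) (y := t) (z := p) (by omega) hp
    (by linear_combination h + hpq)

lemma exists_eq_of_one_six_one {n : ℤ} (hn : 0 ≤ n) :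
    ∃ x y z : ℤ, n = 1 * x ^ 2 + 6 * triZ y + 1 * triZ z := by
  obtain ⟨z, w, y, h⟩ := eq_sq_add_two_mul_sq_add_six_mul_sq (n := 8 * n + 7) (by omega) (by omega)
  have h1 := sq_emod_sixteen z
  have h2 := sq_emod_sixteen w
  have h3 := sq_emod_sixteen y
  obtain ⟨x, rfl⟩ : ∃ x, w = 2 * x := ⟨w / 2, by omega⟩
  exact exists_of_eight_mul_eq (x := x) (y := y) (z := z) (by omega) (by omega)
    (by linear_combination h)

lemma exists_eq_of_one_eight_one {n : ℤ} (hn : 0 ≤ n) :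
    ∃ x y z : ℤ, n = 1 * x ^ 2 + 8 * triZ y + 1 * triZ z := by
  obtain ⟨z, y, x, hy, h⟩ := eq_sq_add_eight_mul_sq_add_eight_mul_sq (n := 8 * n + 9) (by omega)
    (by omega)
  have h1 := sq_emod_sixteen z
  exact exists_of_eight_mul_eq (x := x) (y := y) (z := z) hy (by omega)
    (by linear_combination h)

lemma exists_eq_of_two_one_one {n : ℤ} (hn : 0 ≤ n) :
    ∃ x y z : ℤ, n = 2 * x ^ 2 + 1 * triZ y + 1 * triZ z := by
  obtain ⟨r, s, t, h⟩ := eq_sq_add_sq_add_two_mul_sq (n := 4 * n + 1) (by omega) (by omega)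
  have h1 := sq_emod_sixteen r
  have h2 := sq_emod_sixteen s
  have h3 := sq_emod_sixteen t
  obtain ⟨x, rfl⟩ : ∃ x, t = 2 * x := ⟨t / 2, by omega⟩
  exact exists_of_eight_mul_eq (x := x) (y := r + s) (z := r - s) (by omega) (by omega)
    (by linear_combination 2 * h)

lemma exists_eq_of_two_two_one {n : ℤ} (hn : 0 ≤ n) :
    ∃ x y z : ℤ, n = 2 * x ^ 2 + 2 * triZ y + 1 * triZ z := by
  obtain ⟨r, s, t, h⟩ := eq_sq_add_sq_add_two_mul_sq (n := 8 * n + 3) (by omega) (by omega)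
  have h1 := sq_emod_sixteen r
  have h2 := sq_emod_sixteen s
  have h3 := sq_emod_sixteen t
  rcases Int.emod_two_eq_zero_or_one r with hr | hr
  · obtain ⟨x, rfl⟩ : ∃ x, r = 4 * x := ⟨r / 4, by omega⟩
    exact exists_of_eight_mul_eq (x := x) (y := t) (z := s) (by omega) (by omega)
      (by linear_combination h)
  · obtain ⟨x, rfl⟩ : ∃ x, s = 4 * x := ⟨s / 4, by omega⟩
    exact exists_of_eight_mul_eq (x := x) (y := t) (z := r) (by omega) (by omega)
      (by linear_combination h)

lemma exists_eq_of_two_four_one {n : ℤ} (hn : 0 ≤ n) :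
    ∃ x y z : ℤ, n = 2 * x ^ 2 + 4 * triZ y + 1 * triZ z := by
  obtain ⟨z, y, x, hz, hy, h⟩ := eq_of_five_mod_eight (n := 8 * n + 5) (by omega) (by omega)
  exact exists_of_eight_mul_eq (x := x) hy hz (by linear_combination h)

lemma exists_eq_of_three_two_one {n : ℤ} (hn : 0 ≤ n) :
    ∃ x y z : ℤ, n = 3 * x ^ 2 + 2 * triZ y + 1 * triZ z := by
  obtain ⟨z, y, w, h⟩ := eq_sq_add_two_mul_sq_add_six_mul_sq (n := 8 * n + 3) (by omega) (by omega)
  have h1 := sq_emod_sixteen z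
  have h2 := sq_emod_sixteen w
  have h3 := sq_emod_sixteen y
  obtain ⟨x, rfl⟩ : ∃ x, w = 2 * x := ⟨w / 2, by omega⟩
  exact exists_of_eight_mul_eq (x := x) (y := y) (z := z) (by omega) (by omega)
    (by linear_combination h)

lemma exists_eq_of_four_one_one {n : ℤ} (hn : 0 ≤ n) :
    ∃ x y z : ℤ, n = 4 * x ^ 2 + 1 * triZ y + 1 * triZ z := by
  obtain ⟨s, r, x, hs, h⟩ := eq_sq_add_four_mul_sq_add_sixteen_mul_sq (n := 4 * n + 1) (by omega)
    (by omega)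
  exact exists_of_eight_mul_eq (x := x) (y := s + 2 * r) (z := s - 2 * r) (by omega) (by omega)
    (by linear_combination 2 * h)

lemma exists_eq_of_four_two_one_of_odd {n r s t : ℤ} (hr : r % 2 = 1) (ht : t % 2 = 1)
    (hrs : r ^ 2 % 16 = s ^ 2 % 16) (h : 8 * n + 3 = r ^ 2 + s ^ 2 + t ^ 2) :
    ∃ x y z : ℤ, n = 4 * x ^ 2 + 2 * triZ y + 1 * triZ z := by
  have h1 := sq_emod_sixteen r
  have h2 := sq_emod_sixteen s
  have : (r - s) % 8 = 0 ∨ (r + s) % 8 = 0 := by omega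
  rcases this with h3 | h3
  · obtain ⟨x, hx⟩ : ∃ x, r = s + 8 * x := ⟨(r - s) / 8, by omega⟩
    subst hx
    exact exists_of_eight_mul_eq (x := x) (y := s + 4 * x) (z := t) (by omega) ht
      (by linear_combination h)
  · obtain ⟨x, hx⟩ : ∃ x, r = 8 * x - s := ⟨(r + s) / 8, by omega⟩
    subst hx
    exact exists_of_eight_mul_eq (x := x) (y := s - 4 * x) (z := t) (by omega) ht
      (by linear_combination h)

lemma exists_eq_of_four_two_one {n : ℤ} (hn : 0 ≤ n) :
    ∃ x y z : ℤ, n = 4 * x ^ 2 + 2 * triZ y + 1 * triZ z := by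
  obtain ⟨r, s, t, hr, hs, ht, h⟩ := eq_of_three_mod_eight (n := 8 * n + 3) (by omega) (by omega)
  have h1 := sq_emod_sixteen r
  have h2 := sq_emod_sixteen s
  have h3 := sq_emod_sixteen t
  have : r ^ 2 % 16 = s ^ 2 % 16 ∨ r ^ 2 % 16 = t ^ 2 % 16 ∨ s ^ 2 % 16 = t ^ 2 % 16 := by omega
  rcases this with h4 | h4 | h4
  · exact exists_eq_of_four_two_one_of_odd hr ht h4 h
  · exact exists_eq_of_four_two_one_of_odd hr hs h4 (by linear_combination h)
  · exact exists_eq_of_four_two_one_of_odd hs hr h4 (by linear_combination h)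

lemma exists_nat_triZ_eq (k : ℤ) : ∃ m : ℕ, triZ k = (m * (m + 1) / 2 : ℕ) := by
  rcases le_or_gt 0 k with hk | hk
  · lift k to ℕ using hk
    exact ⟨k, by simp [triZ]⟩
  · obtain ⟨m, hm⟩ : ∃ m : ℕ, k = -1 - m := ⟨(-1 - k).toNat, by omega⟩
    subst hm
    exact ⟨m, by simp only [triZ]; push_cast; congr 1; ring⟩

lemma exists_lt_eq_of_eq {n a b c : ℕ} (ha : 0 < a) (hb : 0 < b) (hc : 0 < c) (hn : n ≤ 20)
    (h : ∃ x y z : ℤ, (n : ℤ) = a * x ^ 2 + b * triZ y + c * triZ z) :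
    ∃ i < 5, ∃ j < 6, ∃ k < 6, n = a * i ^ 2 + b * (j * (j + 1) / 2) + c * (k * (k + 1) / 2) := by
  have lt_six {j : ℕ} (hj : j * (j + 1) / 2 ≤ 20) : j < 6 := by
    by_contra! hj'
    have : 6 * 7 ≤ j * (j + 1) := Nat.mul_le_mul hj' (Nat.succ_le_succ hj')
    omega
  obtain ⟨x, y, z, h⟩ := h
  obtain ⟨j, hj⟩ := exists_nat_triZ_eq y
  obtain ⟨k, hk⟩ := exists_nat_triZ_eq z
  rw [hj, hk, ← Int.natAbs_sq] at h
  norm_cast at h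
  have h1 := Nat.le_mul_of_pos_left (x.natAbs ^ 2) ha
  have h2 := Nat.le_mul_of_pos_left (j * (j + 1) / 2) hb
  have h3 := Nat.le_mul_of_pos_left (k * (k + 1) / 2) hc
  exact ⟨x.natAbs, lt_of_pow_lt_pow_left₀ 2 (by omega) (by omega), j, lt_six (by omega), k,
    lt_six (by omega), h⟩

set_option maxHeartbeats 1000000 in
lemma bounds_of_universal {a b c : ℕ} (ha : 0 < a) (hc : 0 < c) (hbc : c ≤ b)
    (H : ∀ n ≤ 20, ∃ i < 5, ∃ j < 6, ∃ k < 6,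
      n = a * i ^ 2 + b * (j * (j + 1) / 2) + c * (k * (k + 1) / 2)) :
    a ≤ 5 ∧ b ≤ 8 ∧ c ≤ 2 := by
  have h1 : a = 1 ∨ c = 1 := by
    obtain ⟨i, hi, j, hj, k, hk, h⟩ := H 1 (by decide)
    interval_cases i <;> interval_cases j <;> interval_cases k <;> omega
  have h2 : a ≤ 2 ∧ c ≤ 2 ∨ b ≤ 2 := by
    obtain ⟨i, hi, j, hj, k, hk, h⟩ := H 2 (by decide)
    interval_cases i <;> interval_cases j <;> interval_cases k <;> omega
  have h4 : ¬ (2 ≤ a ∧ c = 1 ∧ 5 ≤ b) ∧ ¬ (5 ≤ a ∧ c = 1 ∧ b = 2) := by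
    obtain ⟨i, hi, j, hj, k, hk, h⟩ := H 4 (by decide)
    interval_cases i <;> interval_cases j <;> interval_cases k <;> omega
  have h5 : ¬ (6 ≤ a ∧ c = 1 ∧ b = 1) ∧ ¬ (a = 1 ∧ c = 2 ∧ 6 ≤ b) := by
    obtain ⟨i, hi, j, hj, k, hk, h⟩ := H 5 (by decide)
    interval_cases i <;> interval_cases j <;> interval_cases k <;> omega
  have h8 : ¬ (a = 1 ∧ c = 1 ∧ 9 ≤ b) := by
    rintro ⟨rfl, rfl, hb⟩
    obtain ⟨i, hi, j, hj, k, hk, h⟩ := H 8 (by decide)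
    obtain rfl : j = 0 := by interval_cases j <;> omega
    interval_cases i <;> interval_cases k <;> omega
  omega

lemma eq_of_bounded_universal : ∀ a ∈ Finset.Icc 1 5, ∀ b ∈ Finset.Icc 1 8, ∀ c ∈ Finset.Icc 1 2,
    c ≤ b → (∀ n ≤ 20, ∃ i < 5, ∃ j < 6, ∃ k < 6,
      n = a * i ^ 2 + b * (j * (j + 1) / 2) + c * (k * (k + 1) / 2)) →
    (a, b, c) = (1, 1, 1) ∨ (a, b, c) = (1, 2, 1) ∨ (a, b, c) = (1, 2, 2) ∨
      (a, b, c) = (1, 3, 1) ∨ (a, b, c) = (1, 4, 1) ∨ (a, b, c) = (1, 4, 2) ∨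
      (a, b, c) = (1, 5, 2) ∨ (a, b, c) = (1, 6, 1) ∨ (a, b, c) = (1, 8, 1) ∨
      (a, b, c) = (2, 1, 1) ∨ (a, b, c) = (2, 2, 1) ∨ (a, b, c) = (2, 4, 1) ∨
      (a, b, c) = (3, 2, 1) ∨ (a, b, c) = (4, 1, 1) ∨ (a, b, c) = (4, 2, 1) := by
  decide +kernel

/-- Classification of the universal forms `a·x² + b·t_y + c·t_z` with `b ≥ c`. -/
theorem universal_one_square_two_triangular (a b c : ℕ)
    (ha : 0 < a) (hb : 0 < b) (hc : 0 < c) (hbc : c ≤ b) :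
    (∀ n : ℕ, ∃ x y z : ℤ,
        (n : ℤ) = a * x ^ 2 + b * triZ y + c * triZ z) ↔
      (a, b, c) = (1, 1, 1) ∨ (a, b, c) = (1, 2, 1) ∨ (a, b, c) = (1, 2, 2) ∨
      (a, b, c) = (1, 3, 1) ∨ (a, b, c) = (1, 4, 1) ∨ (a, b, c) = (1, 4, 2) ∨
      (a, b, c) = (1, 5, 2) ∨ (a, b, c) = (1, 6, 1) ∨ (a, b, c) = (1, 8, 1) ∨
      (a, b, c) = (2, 1, 1) ∨ (a, b, c) = (2, 2, 1) ∨ (a, b, c) = (2, 4, 1) ∨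
      (a, b, c) = (3, 2, 1) ∨ (a, b, c) = (4, 1, 1) ∨ (a, b, c) = (4, 2, 1) := by
  constructor
  · intro H
    have H' (n : ℕ) (hn : n ≤ 20) := exists_lt_eq_of_eq ha hb hc hn (H n)
    obtain ⟨ha', hb', hc'⟩ := bounds_of_universal ha hc hbc H'
    exact eq_of_bounded_universal a (Finset.mem_Icc.2 ⟨ha, ha'⟩) b (Finset.mem_Icc.2 ⟨hb, hb'⟩) c
      (Finset.mem_Icc.2 ⟨hc, hc'⟩) hbc H'
  · intro h n
    have hn := Int.natCast_nonneg n
    simp only [Prod.mk.injEq] at h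
    rcases h with ⟨rfl, rfl, rfl⟩ | ⟨rfl, rfl, rfl⟩ | ⟨rfl, rfl, rfl⟩ | ⟨rfl, rfl, rfl⟩ |
      ⟨rfl, rfl, rfl⟩ | ⟨rfl, rfl, rfl⟩ | ⟨rfl, rfl, rfl⟩ | ⟨rfl, rfl, rfl⟩ | ⟨rfl, rfl, rfl⟩ |
      ⟨rfl, rfl, rfl⟩ | ⟨rfl, rfl, rfl⟩ | ⟨rfl, rfl, rfl⟩ | ⟨rfl, rfl, rfl⟩ | ⟨rfl, rfl, rfl⟩ |
      ⟨rfl, rfl, rfl⟩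
    · exact exists_eq_of_one_one_one hn
    · exact exists_eq_of_one_two_one hn
    · exact exists_eq_of_one_two_two hn
    · exact exists_eq_of_one_three_one hn
    · exact exists_eq_of_one_four_one hn
    · exact exists_eq_of_one_four_two hn
    · exact exists_eq_of_one_five_two hn
    · exact exists_eq_of_one_six_one hn
    · exact exists_eq_of_one_eight_one hn
    · exact exists_eq_of_two_one_one hn
    · exact exists_eq_of_two_two_one hn
    · exact exists_eq_of_two_four_one hn
    · exact exists_eq_of_three_two_one hn
    · exact exists_eq_of_four_one_one hn
    · exact exists_eq_of_four_two_one hn
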